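/- arXiv:0911.4038 — 3 statements merged into one kernel-verified Lean document; each statement's English description precedes it below -/
import Mathlib

section
/- Let f(x) = ∑_{k≥0} b_k x^k be holomorphic on the disc B_r(0) with r > 1, and f_λ(x) = ∏_{m=1}^{ℓ(λ)} f(x^{λ_m}). Then for |x| ≤ 1 and |t| < 1, ∑_{n≥0} (∑_{λ ⊢ n} f_λ(x)/z_λ) t^n = ∏_{k≥0} (1 − x^k t)^{−b_k}, with both sides absolutely convergent, and the product is holomorphic in t on the unit disc. -/
open scoped BigOperators

/-- `z_λ = ∏_r r^{c_r} c_r!`. -/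
noncomputable def zPart {n : ℕ} (lam : Nat.Partition n) : ℕ :=
  ∏ r ∈ lam.parts.toFinset, r ^ lam.parts.count r * (lam.parts.count r).factorial

/-- The centralizer-size weight `∏_r r^{c_r} c_r!` of a multiset of natural numbers. -/
def multisetWeight (s : Multiset ℕ) : ℕ :=
  ∏ r ∈ s.toFinset, r ^ s.count r * (s.count r).factorial

lemma multisetWeight_eq (s : Multiset ℕ) (T : Finset ℕ) (h : s.toFinset ⊆ T) :
    multisetWeight s = s.prod * ∏ r ∈ T, (s.count r).factorial := by
  rw [multisetWeight, Finset.prod_mul_distrib, ← Finset.prod_multiset_count]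
  congr 1
  refine Finset.prod_subset h fun r _ hr => ?_
  rw [Multiset.count_eq_zero_of_notMem (by simpa using hr), Nat.factorial_zero]

lemma multisetWeight_cons (m : ℕ) (s : Multiset ℕ) :
    multisetWeight (m ::ₘ s) = m * (m ::ₘ s).count m * multisetWeight s := by
  have hsub : s.toFinset ⊆ (m ::ₘ s).toFinset := by simp
  have hm : m ∈ (m ::ₘ s).toFinset := by simp
  rw [multisetWeight_eq _ _ subset_rfl, multisetWeight_eq s _ hsub, Multiset.prod_cons,
    ← Finset.mul_prod_erase _ _ hm, ← Finset.mul_prod_erase _ (fun r => (s.count r).factorial) hm,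
    Multiset.count_cons_self, Nat.factorial_succ]
  rw [Finset.prod_congr rfl fun r hr => by
    rw [Multiset.count_cons_of_ne (Finset.ne_of_mem_erase hr)]]
  ring

/-- The summand `p_λ / z_λ` for a multiset of parts, where `p_λ = ∏_m p (λ_m)`. -/
noncomputable def partTerm (p : ℕ → ℂ) (s : Multiset ℕ) : ℂ :=
  ((multisetWeight s : ℂ))⁻¹ * (s.map p).prod

lemma partTerm_cons (p : ℕ → ℂ) {m : ℕ} (hm : m ≠ 0) (s : Multiset ℕ) :
    (m * (m ::ₘ s).count m : ℂ) * partTerm p (m ::ₘ s) = p m * partTerm p s := by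
  have h : (m * (m ::ₘ s).count m : ℂ) ≠ 0 := by
    rw [Multiset.count_cons_self]
    exact_mod_cast Nat.mul_ne_zero hm (Nat.succ_ne_zero _)
  rw [partTerm, partTerm, multisetWeight_cons, Multiset.map_cons, Multiset.prod_cons]
  push_cast
  rw [mul_inv]
  linear_combination (p m * ((multisetWeight s : ℂ)⁻¹ * (s.map p).prod)) * mul_inv_cancel₀ h

/-- The cycle-index sum `∑_{λ ⊢ n} p_λ / z_λ`. -/
noncomputable def partitionSum (p : ℕ → ℂ) (n : ℕ) : ℂ :=
  ∑ lam : Nat.Partition n, partTerm p lam.parts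

lemma partitionSum_zero (p : ℕ → ℂ) : partitionSum p 0 = 1 := by
  simp [partitionSum, partTerm, multisetWeight]

lemma sum_mul_count_mul_partTerm (p : ℕ → ℂ) {n m : ℕ} (hm : m ≠ 0) (hmn : m ≤ n) :
    ∑ lam : Nat.Partition n, (m * lam.parts.count m : ℂ) * partTerm p lam.parts =
      p m * partitionSum p (n - m) := by
  rw [partitionSum, Finset.mul_sum]
  symm
  have hsupp : ∀ lam ∈ (Finset.univ : Finset (Nat.Partition n)),
      (m * lam.parts.count m : ℂ) * partTerm p lam.parts ≠ 0 → m ∈ lam.parts := by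
    intro lam _ h
    by_contra hc
    exact h (by simp [Multiset.count_eq_zero_of_notMem hc])
  rw [← Finset.sum_filter_of_ne hsupp]
  refine Finset.sum_bij'
    (fun mu _ => (⟨m ::ₘ mu.parts, ?_, ?_⟩ : Nat.Partition n))
    (fun lam h => (⟨lam.parts.erase m, ?_, ?_⟩ : Nat.Partition (n - m))) ?_ ?_ ?_ ?_ ?_
  · intro i hi
    rcases Multiset.mem_cons.1 hi with rfl | hi
    · exact Nat.pos_of_ne_zero hm
    · exact mu.parts_pos hi
  · rw [Multiset.sum_cons, mu.parts_sum]
    omega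
  · intro i hi
    exact lam.parts_pos (Multiset.mem_of_mem_erase hi)
  · have := Multiset.sum_erase (Finset.mem_filter.1 h).2
    rw [lam.parts_sum] at this
    omega
  · intro mu _
    simp
  · intro lam _
    simp
  · intro mu _
    simp
  · intro lam h
    ext1
    exact Multiset.cons_erase (Finset.mem_filter.1 h).2
  · intro mu _
    exact (partTerm_cons p hm mu.parts).symm

lemma Nat.Partition.sum_mul_count {n : ℕ} (lam : Nat.Partition n) :
    ∑ i ∈ Finset.range n, (i + 1) * lam.parts.count (i + 1) = n := by
  conv_rhs => rw [← lam.parts_sum, Finset.sum_multiset_count]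
  rw [Finset.range_eq_Ico, Finset.sum_Ico_add' (fun i => i * lam.parts.count i) 0 n 1]
  symm
  simp only [smul_eq_mul, mul_comm]
  refine Finset.sum_subset (fun m hm => ?_) fun m _ hm => ?_
  · have hm' := Multiset.mem_toFinset.1 hm
    have := lam.parts_pos hm'
    have := lam.le_of_mem_parts hm'
    rw [Finset.mem_Ico]
    omega
  · rw [Multiset.count_eq_zero_of_notMem (by simpa using hm), mul_zero]

/-- Newton-type recurrence for the cycle-index sums. -/
lemma partitionSum_rec (p : ℕ → ℂ) (n : ℕ) :
    (n : ℂ) * partitionSum p n =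
      ∑ i ∈ Finset.range n, p (i + 1) * partitionSum p (n - (i + 1)) := by
  have h : ∀ i ∈ Finset.range n, p (i + 1) * partitionSum p (n - (i + 1)) =
      ∑ lam : Nat.Partition n,
        (((i + 1 : ℕ) : ℂ) * lam.parts.count (i + 1)) * partTerm p lam.parts := fun i hi =>
    (sum_mul_count_mul_partTerm p i.succ_ne_zero (Finset.mem_range.1 hi)).symm
  rw [Finset.sum_congr rfl h, Finset.sum_comm, partitionSum, Finset.mul_sum]
  refine Finset.sum_congr rfl fun lam _ => ?_
  rw [← Finset.sum_mul]
  congr 1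
  exact_mod_cast lam.sum_mul_count.symm

section PowerSeries

variable {c : ℕ → ℂ} {L : ℂ → ℂ}

lemma hasFPowerSeriesOnBall_of_hasSum_unitBall
    (hL : ∀ u ∈ Metric.ball (0 : ℂ) 1, HasSum (fun n => c n * u ^ n) (L u)) :
    HasFPowerSeriesOnBall L (FormalMultilinearSeries.ofScalars ℂ c) 0 1 where
  r_le := by
    refine ENNReal.le_of_forall_nnreal_lt fun ρ hρ => ?_
    have hρ' : (ρ : ℝ) < 1 := by exact_mod_cast hρ
    refine FormalMultilinearSeries.le_radius_of_summable_norm _ ?_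
    have := (hL (ρ : ℝ) (by simpa using hρ')).summable.norm
    refine this.congr fun n => ?_
    simp [FormalMultilinearSeries.norm_apply_eq_norm_coef]
  r_pos := one_pos
  hasSum := by
    intro y hy
    have hy' : y ∈ Metric.ball (0 : ℂ) 1 := by
      simpa [← Metric.eball_ofReal] using hy
    simpa [FormalMultilinearSeries.apply_eq_pow_smul_coeff, mul_comm] using hL y hy'

lemma differentiableOn_of_hasSum_unitBall
    (hL : ∀ u ∈ Metric.ball (0 : ℂ) 1, HasSum (fun n => c n * u ^ n) (L u)) :
    DifferentiableOn ℂ L (Metric.ball 0 1) := by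
  have := (hasFPowerSeriesOnBall_of_hasSum_unitBall hL).differentiableOn
  simpa [← Metric.eball_ofReal] using this

lemma iteratedDeriv_of_hasSum_unitBall
    (hL : ∀ u ∈ Metric.ball (0 : ℂ) 1, HasSum (fun n => c n * u ^ n) (L u)) (n : ℕ) :
    iteratedDeriv n L 0 = n.factorial * c n := by
  have := (hasFPowerSeriesOnBall_of_hasSum_unitBall hL).factorial_smul 1 n
  rw [iteratedDeriv_eq_iteratedFDeriv, ← this]
  simp

/-- The Taylor coefficients of `exp (∑ c_n u^n)` are determined by the recurrence that
differentiating `exp L` gives. -/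
lemma hasSum_cexp_of_rec {a : ℕ → ℂ} (hc : c 0 = 0)
    (hL : ∀ u ∈ Metric.ball (0 : ℂ) 1, HasSum (fun n => c n * u ^ n) (L u))
    (ha0 : a 0 = 1)
    (ha : ∀ n : ℕ, ((n + 1 : ℕ) : ℂ) * a (n + 1) =
      ∑ i ∈ Finset.range (n + 1), ((i + 1 : ℕ) : ℂ) * c (i + 1) * a (n - i))
    {u : ℂ} (hu : u ∈ Metric.ball (0 : ℂ) 1) :
    HasSum (fun n => a n * u ^ n) (Complex.exp (L u)) := by
  have hdiff := differentiableOn_of_hasSum_unitBall hL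
  have hexp : DifferentiableOn ℂ (fun u => Complex.exp (L u)) (Metric.ball 0 1) := hdiff.cexp
  have hmem : Metric.ball (0 : ℂ) 1 ∈ nhds 0 := Metric.ball_mem_nhds _ one_pos
  have hLan : AnalyticAt ℂ L 0 := hdiff.analyticAt hmem
  have hEan : AnalyticAt ℂ (fun u => Complex.exp (L u)) 0 := hexp.analyticAt hmem
  have hder : deriv (fun u => Complex.exp (L u)) =ᶠ[nhds 0]
      deriv L * fun u => Complex.exp (L u) := by
    filter_upwards [hmem] with v hv
    have := (hdiff.differentiableAt (Metric.isOpen_ball.mem_nhds hv)).hasDerivAt.cexp.deriv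
    rw [this, Pi.mul_apply, mul_comm]
  have hcoef : ∀ n, iteratedDeriv n (fun u => Complex.exp (L u)) 0 = n.factorial * a n := by
    intro n
    induction n using Nat.strong_induction_on with
    | _ n ih =>
      cases n with
      | zero =>
        have := iteratedDeriv_of_hasSum_unitBall hL 0
        rw [iteratedDeriv_zero] at this
        simp [this, hc, ha0]
      | succ n =>
        rw [iteratedDeriv_succ', hder.iteratedDeriv_eq,
          iteratedDeriv_mul hLan.deriv.contDiffAt hEan.contDiffAt, Nat.factorial_succ]
        push_cast
        have h := ha n
        push_cast at h
        rw [mul_right_comm, h, Finset.sum_mul]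
        refine Finset.sum_congr rfl fun i hi => ?_
        have hi' : i ≤ n := Nat.lt_succ_iff.1 (Finset.mem_range.1 hi)
        rw [ih (n - i) (by omega), ← iteratedDeriv_succ', iteratedDeriv_of_hasSum_unitBall hL,
          Nat.factorial_succ, ← Nat.choose_mul_factorial_mul_factorial hi']
        push_cast
        ring
  refine (Complex.hasSum_taylorSeries_on_ball hexp hu).congr_fun fun n => ?_
  have : (n.factorial : ℂ) ≠ 0 := by exact_mod_cast n.factorial_ne_zero
  rw [hcoef, sub_zero, smul_eq_mul, smul_eq_mul]
  field_simp

end PowerSeries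

/-- Summing the logarithmic series of `-b_k log (1 - x^k u)` over `k` and `n` in either order. -/
lemma hasSum_log_of_hasSum_pow {b : ℕ → ℂ} {f : ℂ → ℂ} (hb : Summable fun k => ‖b k‖)
    {x u : ℂ} (hx : ‖x‖ ≤ 1) (hu : ‖u‖ < 1)
    (hf : ∀ n : ℕ, HasSum (fun k => b k * (x ^ n) ^ k) (f (x ^ n))) :
    ∃ l : ℂ, HasSum (fun n : ℕ => f (x ^ n) / n * u ^ n) l ∧
      HasSum (fun k : ℕ => -b k * Complex.log (1 - x ^ k * u)) l := by
  have hS : Summable fun q : ℕ × ℕ => b q.1 * ((x ^ q.1 * u) ^ q.2 / q.2) := by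
    refine Summable.of_norm_bounded (hb.mul_of_nonneg
      (summable_geometric_of_lt_one (norm_nonneg u) hu) (fun _ => norm_nonneg _)
      (fun _ => pow_nonneg (norm_nonneg _) _)) fun q => ?_
    rw [norm_mul, norm_div, norm_pow, norm_mul, norm_pow]
    refine mul_le_mul_of_nonneg_left ?_ (norm_nonneg _)
    have h1 : (‖x‖ ^ q.1 * ‖u‖) ^ q.2 ≤ ‖u‖ ^ q.2 := by
      gcongr
      exact mul_le_of_le_one_left (norm_nonneg _) (pow_le_one₀ (norm_nonneg _) hx)
    rcases Nat.eq_zero_or_pos q.2 with h | h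
    · simp [h]
    · refine (div_le_self (by positivity) ?_).trans h1
      rw [Complex.norm_natCast]
      exact_mod_cast h
  refine ⟨∑' q : ℕ × ℕ, b q.1 * ((x ^ q.1 * u) ^ q.2 / q.2), ?_, ?_⟩
  · have hsw := (Equiv.prodComm ℕ ℕ).hasSum_iff.2 hS.hasSum
    refine hsw.prod_fiberwise fun n => ?_
    refine (((hf n).div_const (n : ℂ)).mul_right (u ^ n)).congr_fun fun k => ?_
    simp only [Function.comp_apply, Equiv.prodComm_apply, Prod.swap_prod_mk]
    rw [mul_pow, ← pow_mul, ← pow_mul, mul_comm k n]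
    ring
  · refine hS.hasSum.prod_fiberwise fun k => ?_
    have hk : ‖x ^ k * u‖ < 1 := by
      rw [norm_mul, norm_pow]
      exact (mul_le_of_le_one_left (norm_nonneg _) (pow_le_one₀ (norm_nonneg _) hx)).trans_lt hu
    rw [neg_mul_comm]
    exact (Complex.hasSum_taylorSeries_neg_log hk).mul_left (b k)

/-- For `f(x) = ∑_k b_k x^k` holomorphic on the disc `B_r(0)` with `r > 1`, setting
`f_λ(x) = ∏_m f(x^{λ_m})`, for `|x| ≤ 1` and `|t| < 1`:
`∑_n (∑_{λ ⊢ n} f_λ(x)/z_λ) t^n = ∏_{k ≥ 0} (1 - x^k t)^{-b_k}`, both sides being absolutely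
convergent, and the product is holomorphic in `t` on the unit disc. -/
theorem stmt7 (r : ℝ) (hr : 1 < r) (f : ℂ → ℂ) (b : ℕ → ℂ)
    (hf : DifferentiableOn ℂ f (Metric.ball 0 r))
    (hb : ∀ z ∈ Metric.ball (0 : ℂ) r, HasSum (fun k : ℕ => b k * z ^ k) (f z))
    (x t : ℂ) (hx : ‖x‖ ≤ 1) (ht : ‖t‖ < 1) :
    Summable
      (fun n : ℕ =>
        ‖(∑ lam : Nat.Partition n,
            ((zPart lam : ℂ))⁻¹ * (lam.parts.map fun m => f (x ^ m)).prod) * t ^ n‖) ∧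
    Multipliable (fun k : ℕ => (1 - x ^ k * t) ^ (-(b k))) ∧
    HasSum
      (fun n : ℕ =>
        (∑ lam : Nat.Partition n,
            ((zPart lam : ℂ))⁻¹ * (lam.parts.map fun m => f (x ^ m)).prod) * t ^ n)
      (∏' k : ℕ, (1 - x ^ k * t) ^ (-(b k))) ∧
    DifferentiableOn ℂ (fun u : ℂ => ∏' k : ℕ, (1 - x ^ k * u) ^ (-(b k)))
      (Metric.ball 0 1) := by
  have hmem : ∀ n : ℕ, x ^ n ∈ Metric.ball (0 : ℂ) r := fun n => by
    rw [mem_ball_zero_iff, norm_pow]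
    exact (pow_le_one₀ (norm_nonneg _) hx).trans_lt hr
  have hbs : Summable fun k => ‖b k‖ := by
    simpa using (hb 1 (by simpa using hr)).summable.norm
  have hlog : ∀ u : ℂ, ∃ l : ℂ, u ∈ Metric.ball (0 : ℂ) 1 →
      HasSum (fun n : ℕ => f (x ^ n) / n * u ^ n) l ∧
      HasSum (fun k : ℕ => -b k * Complex.log (1 - x ^ k * u)) l := fun u => by
    by_cases hu : u ∈ Metric.ball (0 : ℂ) 1
    · obtain ⟨l, hl⟩ := hasSum_log_of_hasSum_pow hbs hx (mem_ball_zero_iff.1 hu)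
        fun n => hb _ (hmem n)
      exact ⟨l, fun _ => hl⟩
    · exact ⟨0, fun h => absurd h hu⟩
  choose L hL using hlog
  have hprod : ∀ u ∈ Metric.ball (0 : ℂ) 1,
      HasProd (fun k : ℕ => (1 - x ^ k * u) ^ (-(b k))) (Complex.exp (L u)) := by
    intro u hu
    have hne : ∀ k : ℕ, 1 - x ^ k * u ≠ 0 := fun k h0 => by
      have h1 : ‖x ^ k * u‖ < 1 := by
        rw [norm_mul, norm_pow]
        exact (mul_le_of_le_one_left (norm_nonneg _)
          (pow_le_one₀ (norm_nonneg _) hx)).trans_lt (mem_ball_zero_iff.1 hu)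
      rw [← sub_eq_zero.1 h0, norm_one] at h1
      exact lt_irrefl _ h1
    convert (hL u hu).2.cexp using 2 with k
    rw [Complex.cpow_def_of_ne_zero (hne k), Function.comp_apply, mul_comm]
  have htb : t ∈ Metric.ball (0 : ℂ) 1 := mem_ball_zero_iff.2 ht
  have hsum : HasSum (fun n : ℕ => partitionSum (fun m => f (x ^ m)) n * t ^ n)
      (Complex.exp (L t)) := by
    refine hasSum_cexp_of_rec (c := fun n : ℕ => f (x ^ n) / n) (by simp)
      (fun u hu => (hL u hu).1) (partitionSum_zero _) (fun n => ?_) htb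
    rw [partitionSum_rec]
    refine Finset.sum_congr rfl fun i _ => ?_
    rw [mul_div_cancel₀ _ (Nat.cast_ne_zero.2 i.succ_ne_zero), Nat.add_sub_add_right]
  refine ⟨hsum.summable.norm, (hprod t htb).multipliable, ?_, ?_⟩
  · rw [(hprod t htb).tprod_eq]
    exact hsum
  · exact (differentiableOn_of_hasSum_unitBall fun u hu => (hL u hu).1).cexp.congr
      fun u hu => (hprod u hu).tprod_eq
end

section
/- Let θ be a random variable on the unit circle S^1 and P(x) = ∑_{k=0}^d b_k x^k a polynomial; set α_k = E[θ^k]. Define for σ ∈ S_n of cycle-type λ the randomized class function W^1(P)(x)(σ) = ∏_{m=1}^{ℓ(λ)} P(θ_m x^{λ_m}) with θ_m iid copies of θ independent of σ. Then ∑_{n≥0} E_n[W^1(P)(x)] t^n = ∏_{k=0}^d (1 − x^k t)^{−b_k α_k} for |t| < 1, |x| ≤ 1, where E_n denotes expectation over uniform σ ∈ S_n and the θ_m. -/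
open scoped BigOperators Classical
open MeasureTheory

/-- The cycle representatives of `σ`: the least point of each cycle (including fixed points). -/
noncomputable def cycleReps {n : ℕ} (σ : Equiv.Perm (Fin n)) : Finset (Fin n) :=
  Finset.univ.filter fun i => ∀ j, σ.SameCycle i j → i ≤ j

/-- The length of the cycle of `σ` containing `i`. -/
noncomputable def cycleLen {n : ℕ} (σ : Equiv.Perm (Fin n)) (i : Fin n) : ℕ :=
  (Finset.univ.filter fun j => σ.SameCycle i j).card

/-- The permutation of `Fin (n + 1)` obtained from `σ` by inserting the last point just before `p`
in its cycle, or as a new fixed point if `p = none`. -/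
noncomputable def insertLast {n : ℕ} (p : Option (Fin n)) (σ : Equiv.Perm (Fin n)) :
    Equiv.Perm (Fin (n + 1)) :=
  finSuccEquivLast.permCongr.symm (Equiv.Perm.decomposeOption.symm (p, σ))

lemma insertLast_last {n : ℕ} (p : Option (Fin n)) (σ : Equiv.Perm (Fin n)) :
    insertLast p σ (Fin.last n) = finSuccEquivLast.symm p := by
  simp [insertLast, Equiv.permCongr_def]

lemma insertLast_castSucc {n : ℕ} (p : Option (Fin n)) (σ : Equiv.Perm (Fin n)) (i : Fin n) :
    insertLast p σ i.castSucc = if some (σ i) = p then Fin.last n else (σ i).castSucc := by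
  rcases p with _ | q
  · simp [insertLast, Equiv.permCongr_def]
  · by_cases h : σ i = q <;>
      simp [insertLast, Equiv.permCongr_def, Equiv.swap_apply_def, h]

lemma Equiv.Perm.SameCycle.rel_of_equivalence {α : Type*} {σ : Equiv.Perm α} {r : α → α → Prop}
    (hr : Equivalence r) (h : ∀ a, r a (σ a)) {a b : α} (hab : σ.SameCycle a b) : r a b := by
  obtain ⟨k, rfl⟩ := hab
  induction k using Int.induction_on with
  | zero => exact hr.refl a
  | succ k ih =>
    rw [add_comm, zpow_add, zpow_one]
    exact hr.trans ih (h _)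
  | pred k ih =>
    refine hr.trans ih (hr.symm ?_)
    convert h _ using 1
    rw [sub_eq_add_neg, add_comm, zpow_add, zpow_neg_one]
    simp

lemma insertLast_sameCycle_castSucc {n : ℕ} (p : Option (Fin n)) (σ : Equiv.Perm (Fin n))
    (i j : Fin n) :
    (insertLast p σ).SameCycle i.castSucc j.castSucc ↔ σ.SameCycle i j := by
  constructor
  · intro h
    let π : Fin (n + 1) → Option (Quotient (Equiv.Perm.SameCycle.setoid σ)) := fun a =>
      (((finSuccEquivLast a).or p).map (Quotient.mk _))
    have hπ : ∀ k : Fin n, π k.castSucc = some (Quotient.mk _ k) := fun k => by simp [π]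
    have hl : π (Fin.last n) = p.map (Quotient.mk _) := by simp [π]
    have hσ : ∀ k : Fin n, (Quotient.mk (Equiv.Perm.SameCycle.setoid σ) (σ k)) =
        Quotient.mk _ k :=
      fun k => Quotient.sound (Equiv.Perm.sameCycle_apply_left.2 (.refl _ _))
    have hij := h.rel_of_equivalence (r := fun a b => π a = π b)
      ⟨fun _ => rfl, Eq.symm, Eq.trans⟩ fun a => ?_
    · rw [hπ, hπ] at hij
      exact Quotient.exact (Option.some.inj hij)
    · induction a using Fin.lastCases with
      | last => rcases p with _ | q <;> simp [insertLast_last, hπ, hl]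
      | cast k =>
        rw [insertLast_castSucc]
        split_ifs with hk
        · rw [hπ, hl, ← hk, Option.map_some, hσ]
        · rw [hπ, hπ, hσ]
  · refine fun h => h.rel_of_equivalence
      (r := fun i j => (insertLast p σ).SameCycle i.castSucc j.castSucc)
      ⟨fun _ => .refl _ _, fun h => h.symm, Equiv.Perm.SameCycle.trans⟩ fun k => ?_
    by_cases hk : some (σ k) = p
    · have h1 : insertLast p σ (insertLast p σ k.castSucc) = (σ k).castSucc := by
        rw [insertLast_castSucc, if_pos hk, insertLast_last, ← hk]
        simp
      rw [← h1]
      simp [Equiv.Perm.sameCycle_apply_right, Equiv.Perm.SameCycle.refl]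
    · have h1 : insertLast p σ k.castSucc = (σ k).castSucc := by
        rw [insertLast_castSucc, if_neg hk]
      rw [← h1]
      simp [Equiv.Perm.sameCycle_apply_right, Equiv.Perm.SameCycle.refl]

lemma insertLast_none_sameCycle_last {n : ℕ} (σ : Equiv.Perm (Fin n)) (j : Fin n) :
    ¬ (insertLast none σ).SameCycle (Fin.last n) j.castSucc := by
  have hl : Function.IsFixedPt (insertLast none σ) (Fin.last n) := by
    simp [Function.IsFixedPt, insertLast_last]
  intro h
  exact (Fin.castSucc_lt_last j).ne' (h.eq_of_left hl)

lemma insertLast_some_sameCycle_last {n : ℕ} (q : Fin n) (σ : Equiv.Perm (Fin n)) (j : Fin n) :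
    (insertLast (some q) σ).SameCycle (Fin.last n) j.castSucc ↔ σ.SameCycle q j := by
  rw [← insertLast_sameCycle_castSucc (some q), ← Equiv.Perm.sameCycle_apply_left,
    insertLast_last, finSuccEquivLast_symm_some]

/-- The product over the cycles of `σ` of the weight `f` of their lengths. -/
noncomputable def cycleWeight {R : Type*} [CommRing R] (f : ℕ → R) {n : ℕ}
    (σ : Equiv.Perm (Fin n)) : R :=
  ∏ i ∈ cycleReps σ, f (cycleLen σ i)

lemma cycleWeight_insertLast_none {R : Type*} [CommRing R] (f : ℕ → R) {n : ℕ}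
    (σ : Equiv.Perm (Fin n)) :
    cycleWeight f (insertLast none σ) = f 1 * cycleWeight f σ := by
  have hlen : ∀ i : Fin n, cycleLen (insertLast none σ) i.castSucc = cycleLen σ i := fun i => by
    simp [cycleLen, Finset.card_filter, Fin.sum_univ_castSucc, -Finset.sum_boole,
      insertLast_sameCycle_castSucc,
      Equiv.Perm.sameCycle_comm (y := Fin.last n), insertLast_none_sameCycle_last]
  have hlast : cycleLen (insertLast none σ) (Fin.last n) = 1 := by
    simp [cycleLen, Finset.card_filter, Fin.sum_univ_castSucc, -Finset.sum_boole,
      insertLast_none_sameCycle_last,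
      Equiv.Perm.SameCycle.refl]
  simp [cycleWeight, cycleReps, Finset.prod_filter, Fin.prod_univ_castSucc, Fin.forall_fin_succ',
    insertLast_sameCycle_castSucc, hlen, hlast, insertLast_none_sameCycle_last, mul_comm,
    Fin.le_last]

lemma cycleWeight_insertLast_some {R : Type*} [CommRing R] (f : ℕ → R) {n : ℕ}
    (σ : Equiv.Perm (Fin n)) (q : Fin n) :
    cycleWeight f (insertLast (some q) σ) =
      ∏ i ∈ cycleReps σ, f (cycleLen σ i + if σ.SameCycle i q then 1 else 0) := by
  have hlen : ∀ i : Fin n, cycleLen (insertLast (some q) σ) i.castSucc =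
      cycleLen σ i + if σ.SameCycle i q then 1 else 0 := fun i => by
    simp [cycleLen, Finset.card_filter, Fin.sum_univ_castSucc, -Finset.sum_boole,
      insertLast_sameCycle_castSucc,
      Equiv.Perm.sameCycle_comm (y := Fin.last n), insertLast_some_sameCycle_last,
      Equiv.Perm.sameCycle_comm (x := q)]
  have hrep : ¬ ∀ j, (insertLast (some q) σ).SameCycle (Fin.last n) j → Fin.last n ≤ j :=
    fun h => (Fin.castSucc_lt_last q).not_ge
      (h _ ((insertLast_some_sameCycle_last q σ q).2 (.refl _ _)))
  simp only [cycleWeight, cycleReps, Finset.prod_filter, Fin.prod_univ_castSucc, if_neg hrep,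
    mul_one, hlen]
  simp [Fin.forall_fin_succ', insertLast_sameCycle_castSucc, Fin.le_last]

/-- Summing over the point before which a new one is inserted amounts to lengthening each cycle in
turn, with multiplicity its length. -/
lemma sum_prod_cycleReps_insert {R : Type*} [CommRing R] (f : ℕ → R) {n : ℕ}
    (σ : Equiv.Perm (Fin n)) :
    ∑ q, ∏ i ∈ cycleReps σ, f (cycleLen σ i + if σ.SameCycle i q then 1 else 0) =
      ∑ i ∈ cycleReps σ, (∏ j ∈ (cycleReps σ).erase i, f (cycleLen σ j)) *
        (cycleLen σ i * f (cycleLen σ i + 1)) := by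
  have hrep : ∀ q : Fin n, ∃ i ∈ cycleReps σ, σ.SameCycle i q := fun q => by
    obtain ⟨i, hi, hmin⟩ := (Finset.univ.filter fun j => σ.SameCycle q j).exists_min_image id
      ⟨q, by simp [Equiv.Perm.SameCycle.refl]⟩
    simp only [Finset.mem_filter, Finset.mem_univ, true_and, id] at hi hmin
    exact ⟨i, by simpa [cycleReps] using fun j hj => hmin j (hi.trans hj), hi.symm⟩
  have huniq : ∀ i ∈ cycleReps σ, ∀ j ∈ cycleReps σ, σ.SameCycle i j → i = j := by
    intro i hi j hj h
    simp only [cycleReps, Finset.mem_filter, Finset.mem_univ, true_and] at hi hj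
    exact le_antisymm (hi j h) (hj i h.symm)
  have hq : ∀ q : Fin n,
      ∏ i ∈ cycleReps σ, f (cycleLen σ i + if σ.SameCycle i q then 1 else 0) =
      ∑ i ∈ cycleReps σ, if σ.SameCycle i q then
        (∏ j ∈ (cycleReps σ).erase i, f (cycleLen σ j)) * f (cycleLen σ i + 1) else 0 := by
    intro q
    obtain ⟨i, hi, hiq⟩ := hrep q
    have hne : ∀ j ∈ cycleReps σ, j ≠ i → ¬ σ.SameCycle j q :=
      fun j hj hji h => hji (huniq j hj i hi (h.trans hiq.symm))
    rw [Finset.sum_eq_single_of_mem i hi fun j hj hji => if_neg (hne j hj hji), if_pos hiq,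
      ← Finset.prod_erase_mul _ _ hi, if_pos hiq]
    congr 1
    refine Finset.prod_congr rfl fun j hj => ?_
    rw [Finset.mem_erase] at hj
    rw [if_neg (hne j hj.2 hj.1), add_zero]
  simp_rw [hq]
  rw [Finset.sum_comm]
  refine Finset.sum_congr rfl fun i _ => ?_
  rw [← Finset.sum_filter, Finset.sum_const, nsmul_eq_mul, cycleLen]
  ring

lemma sum_cycleWeight_succ {R : Type*} [CommRing R] (f : ℕ → R) (n : ℕ) :
    ∑ τ : Equiv.Perm (Fin (n + 1)), cycleWeight f τ =
      f 1 * ∑ σ : Equiv.Perm (Fin n), cycleWeight f σ +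
      ∑ σ : Equiv.Perm (Fin n), ∑ i ∈ cycleReps σ,
        (∏ j ∈ (cycleReps σ).erase i, f (cycleLen σ j)) *
          (cycleLen σ i * f (cycleLen σ i + 1)) := by
  rw [← ((finSuccEquivLast.permCongr.trans Equiv.Perm.decomposeOption).symm).sum_comp,
    Fintype.sum_prod_type_right, Finset.mul_sum, ← Finset.sum_add_distrib]
  refine Finset.sum_congr rfl fun σ _ => ?_
  rw [Fintype.sum_option, ← sum_prod_cycleReps_insert]
  simp_rw [← cycleWeight_insertLast_some]
  rw [← cycleWeight_insertLast_none]
  rfl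

/-- If `g` has derivative `f 1 * g` and each `f l` has derivative `l * f (l + 1)`, then the iterated
derivatives of `g` are `g` times the total cycle weights. -/
lemma iteratedDeriv_eq_sum_cycleWeight_mul {U : Set ℂ} (hU : IsOpen U) {f : ℕ → ℂ → ℂ}
    {g : ℂ → ℂ}
    (hf : ∀ l, ∀ s ∈ U, HasDerivAt (f l) (l * f (l + 1) s) s)
    (hg : ∀ s ∈ U, HasDerivAt g (f 1 s * g s) s) (n : ℕ) :
    ∀ s ∈ U, iteratedDeriv n g s =
      (∑ σ : Equiv.Perm (Fin n), cycleWeight (fun l => f l s) σ) * g s := by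
  induction n with
  | zero => simp [cycleWeight, cycleReps]
  | succ n ih =>
    intro s hs
    rw [iteratedDeriv_succ,
      Filter.EventuallyEq.deriv_eq (Filter.eventually_of_mem (hU.mem_nhds hs) ih)]
    have h1 : HasDerivAt (fun s => ∑ σ : Equiv.Perm (Fin n), cycleWeight (fun l => f l s) σ)
        (∑ σ : Equiv.Perm (Fin n), ∑ i ∈ cycleReps σ,
          (∏ j ∈ (cycleReps σ).erase i, f (cycleLen σ j) s) *
            (cycleLen σ i * f (cycleLen σ i + 1) s)) s :=
      HasDerivAt.fun_sum fun σ _ => HasDerivAt.fun_finsetProd fun i _ => hf _ s hs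
    rw [(h1.fun_mul (hg s hs)).deriv, sum_cycleWeight_succ]
    ring

lemma one_sub_mul_mem_slitPlane {y s : ℂ} (hy : ‖y‖ ≤ 1) (hs : ‖s‖ < 1) :
    1 - y * s ∈ Complex.slitPlane := by
  rw [sub_eq_add_neg]
  refine Complex.mem_slitPlane_of_norm_lt_one ?_
  rw [norm_neg, norm_mul]
  nlinarith [norm_nonneg y, norm_nonneg s]

lemma hasSum_sum_cycleWeight {ι : Type*} (K : Finset ι) (c y : ι → ℂ) (hy : ∀ k ∈ K, ‖y k‖ ≤ 1)
    {t : ℂ} (ht : ‖t‖ < 1) :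
    HasSum (fun n : ℕ => ((Nat.factorial n : ℂ))⁻¹ *
        (∑ σ : Equiv.Perm (Fin n), cycleWeight (fun l => ∑ k ∈ K, c k * y k ^ l) σ) * t ^ n)
      (∏ k ∈ K, (1 - y k * t) ^ (-c k)) := by
  let f : ℕ → ℂ → ℂ := fun l s => ∑ k ∈ K, c k * (y k / (1 - y k * s)) ^ l
  let g : ℂ → ℂ := fun s => ∏ k ∈ K, (1 - y k * s) ^ (-c k)
  have hslit : ∀ k ∈ K, ∀ s ∈ Metric.ball (0 : ℂ) 1, 1 - y k * s ∈ Complex.slitPlane :=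
    fun k hk s hs => one_sub_mul_mem_slitPlane (hy k hk) (by simpa using hs)
  have hlin : ∀ k s, HasDerivAt (fun s => 1 - y k * s) (-y k) s := fun k s => by
    simpa using ((hasDerivAt_id s).const_mul (y k)).const_sub 1
  have hf : ∀ l, ∀ s ∈ Metric.ball (0 : ℂ) 1, HasDerivAt (f l) (l * f (l + 1) s) s := by
    intro l s hs
    simp only [f, Finset.mul_sum]
    refine HasDerivAt.fun_sum fun k hk => ?_
    have h0 := Complex.slitPlane_ne_zero (hslit k hk s hs)
    refine ((((hasDerivAt_const s (y k)).fun_div (hlin k s) h0).fun_pow l).const_mul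
      (c k)).congr_deriv ?_
    generalize 1 - y k * s = u at h0 ⊢
    rcases l with _ | l
    · simp
    · simp only [Nat.add_sub_cancel, div_pow]
      field_simp
      ring
  have hg : ∀ s ∈ Metric.ball (0 : ℂ) 1, HasDerivAt g (f 1 s * g s) s := by
    intro s hs
    have h := HasDerivAt.fun_finsetProd (u := K)
      fun k hk => (hlin k s).cpow_const (c := -c k) (hslit k hk s hs)
    refine h.congr_deriv ?_
    simp only [f, g, Finset.sum_mul]
    refine Finset.sum_congr rfl fun k hk => ?_
    have h0 := Complex.slitPlane_ne_zero (hslit k hk s hs)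
    rw [← Finset.prod_erase_mul _ _ hk, Complex.cpow_sub _ _ h0, Complex.cpow_one, smul_eq_mul]
    ring
  have htaylor := Complex.hasSum_taylorSeries_on_ball (c := 0) (r := 1) (z := t) (f := g)
    (fun s hs => (hg s hs).differentiableAt.differentiableWithinAt) (by simpa using ht)
  refine htaylor.congr_fun fun n => ?_
  rw [iteratedDeriv_eq_sum_cycleWeight_mul Metric.isOpen_ball hf hg n 0 (by simp)]
  simp [f, g]
  ring

lemma integral_prod_cycleReps {Ω : Type*} [MeasurableSpace Ω] (μ : Measure Ω)
    [IsProbabilityMeasure μ] (F : ℕ → Ω → ℂ) {n : ℕ} (σ : Equiv.Perm (Fin n)) :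
    ∫ ω : Fin n → Ω, ∏ i ∈ cycleReps σ, F (cycleLen σ i) (ω i) ∂(Measure.pi fun _ => μ) =
      cycleWeight (fun l => ∫ ω, F l ω ∂μ) σ := by
  have h := integral_fintype_prod_eq_prod (μ := fun _ : Fin n => μ)
    (fun i ω => if i ∈ cycleReps σ then F (cycleLen σ i) ω else 1)
  simp only [Finset.prod_ite_mem, Finset.univ_inter] at h
  rw [h, cycleWeight, ← Finset.prod_subset (Finset.subset_univ (cycleReps σ))]
  · exact Finset.prod_congr rfl fun i hi => by simp [hi]
  · intro i _ hi
    simp [hi]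

lemma integral_eval_mul {Ω : Type*} [MeasurableSpace Ω] (μ : Measure Ω) [IsProbabilityMeasure μ]
    {θ : Ω → ℂ} (hθmeas : Measurable θ) (hθ : ∀ ω, ‖θ ω‖ = 1) (P : Polynomial ℂ) (z : ℂ) :
    ∫ ω, P.eval (θ ω * z) ∂μ =
      ∑ k ∈ Finset.range (P.natDegree + 1), P.coeff k * (∫ ω, θ ω ^ k ∂μ) * z ^ k := by
  have hint : ∀ k, Integrable (fun ω => θ ω ^ k) μ := fun k =>
    Integrable.of_bound (hθmeas.pow_const k).aestronglyMeasurable 1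
      (Filter.Eventually.of_forall fun ω => by simp [hθ])
  simp_rw [Polynomial.eval_eq_sum_range, mul_pow, ← mul_assoc]
  rw [integral_finsetSum _ fun k _ => ((hint k).const_mul _).mul_const _]
  refine Finset.sum_congr rfl fun k _ => ?_
  rw [integral_mul_const, integral_const_mul]

/-- Generating function for the first randomized class function `W^1(P)(x)`:
one iid copy of `θ` (a random variable on the unit circle) per cycle.  With
`α_k = E[θ^k]`, for `|t| < 1` and `|x| ≤ 1`,
`∑_n E_n[W^1(P)(x)] t^n = ∏_k (1 - x^k t)^{-b_k α_k}`. -/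
theorem stmt8 {Ω : Type*} [MeasurableSpace Ω] (μ : Measure Ω) [IsProbabilityMeasure μ]
    (θ : Ω → ℂ) (hθmeas : Measurable θ) (hθ : ∀ ω, ‖θ ω‖ = 1)
    (P : Polynomial ℂ) (x t : ℂ) (hx : ‖x‖ ≤ 1) (ht : ‖t‖ < 1) :
    HasSum
      (fun n : ℕ =>
        ((Nat.factorial n : ℂ))⁻¹ *
          (∑ σ : Equiv.Perm (Fin n),
            ∫ ω : Fin n → Ω,
              ∏ i ∈ cycleReps σ, P.eval (θ (ω i) * x ^ cycleLen σ i)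
              ∂(Measure.pi fun _ : Fin n => μ)) * t ^ n)
      (∏ k ∈ Finset.range (P.natDegree + 1),
        (1 - x ^ k * t) ^ (-(P.coeff k * ∫ ω, θ ω ^ k ∂μ))) := by
  have h := hasSum_sum_cycleWeight (Finset.range (P.natDegree + 1))
    (fun k => P.coeff k * ∫ ω, θ ω ^ k ∂μ) (fun k => x ^ k)
    (fun k _ => by simpa using pow_le_one₀ (norm_nonneg x) hx) ht
  convert h using 5 with n σ
  rw [integral_prod_cycleReps μ (fun l ω => P.eval (θ ω * x ^ l))]
  congr 1
  funext l
  rw [integral_eval_mul μ hθmeas hθ]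
  simp only [← pow_mul, mul_comm l]
end

section
/- Let c_1,…,c_n ∈ ℕ with ∑_{m=1}^n m·c_m = n. Then the probability that a uniformly random permutation σ ∈ S_n has exactly c_m cycles of length m for each m = 1,…,n equals ∏_{m=1}^n (1/m)^{c_m} · (1/c_m!). -/
open scoped BigOperators Classical

/-- The multiset in which each `k ∈ s` is repeated `c k` times. -/
def multisetOfCounts (s : Finset ℕ) (c : ℕ → ℕ) : Multiset ℕ := ∑ k ∈ s, c k • {k}

lemma count_multisetOfCounts (s : Finset ℕ) (c : ℕ → ℕ) (k : ℕ) :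
    (multisetOfCounts s c).count k = if k ∈ s then c k else 0 := by
  simp [multisetOfCounts, Multiset.count_sum', Multiset.count_singleton]

lemma mem_of_mem_multisetOfCounts {s : Finset ℕ} {c : ℕ → ℕ} {k : ℕ}
    (h : k ∈ multisetOfCounts s c) : k ∈ s := by
  by_contra hk
  have := Multiset.count_pos.mpr h
  rw [count_multisetOfCounts, if_neg hk] at this
  exact this.false

lemma sum_multisetOfCounts (s : Finset ℕ) (c : ℕ → ℕ) :
    (multisetOfCounts s c).sum = ∑ k ∈ s, k * c k := by
  simp [multisetOfCounts, Multiset.sum_sum, Multiset.sum_nsmul, mul_comm]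

lemma prod_multisetOfCounts (s : Finset ℕ) (c : ℕ → ℕ) :
    (multisetOfCounts s c).prod = ∏ k ∈ s, k ^ c k := by
  simp [multisetOfCounts, Multiset.prod_sum, Multiset.prod_nsmul]

lemma prod_factorial_count_multisetOfCounts (s : Finset ℕ) (c : ℕ → ℕ) :
    ∏ k ∈ (multisetOfCounts s c).toFinset, ((multisetOfCounts s c).count k).factorial =
      ∏ k ∈ s, (c k).factorial := by
  rw [Finset.prod_subset (s₂ := s)]
  · refine Finset.prod_congr rfl fun k hk => ?_
    rw [count_multisetOfCounts, if_pos hk]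
  · intro k hk
    exact mem_of_mem_multisetOfCounts (Multiset.mem_toFinset.mp hk)
  · intro k _ hk
    rw [Multiset.mem_toFinset, ← Multiset.count_eq_zero] at hk
    rw [hk, Nat.factorial_zero]

lemma count_partition_parts_of_ne_one {n k : ℕ} (σ : Equiv.Perm (Fin n)) (hk : k ≠ 1) :
    σ.partition.parts.count k = σ.cycleType.count k := by
  simp [Equiv.Perm.parts_partition, Multiset.count_replicate, hk.symm]

lemma count_one_partition_parts {n : ℕ} (σ : Equiv.Perm (Fin n)) :
    σ.partition.parts.count 1 = n - σ.cycleType.sum := by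
  have h : σ.cycleType.count 1 = 0 := Multiset.count_eq_zero.mpr fun h =>
    absurd (Equiv.Perm.two_le_of_mem_cycleType h) (by norm_num)
  simp [Equiv.Perm.parts_partition, h, Equiv.Perm.sum_cycleType]

lemma count_partition_parts_eq_iff {n : ℕ} {c : ℕ → ℕ}
    (hc : n - ∑ k ∈ Finset.Icc 2 n, k * c k = c 1) (σ : Equiv.Perm (Fin n)) :
    (∀ m ∈ Finset.Icc 1 n, σ.partition.parts.count m = c m) ↔
      σ.cycleType = multisetOfCounts (Finset.Icc 2 n) c := by
  constructor
  · intro h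
    ext k
    rw [count_multisetOfCounts]
    split_ifs with hk
    · rw [Finset.mem_Icc] at hk
      rw [← h k (Finset.mem_Icc.mpr (by omega)), count_partition_parts_of_ne_one σ (by omega)]
    · rw [Multiset.count_eq_zero]
      intro hmem
      refine hk (Finset.mem_Icc.mpr ⟨Equiv.Perm.two_le_of_mem_cycleType hmem, ?_⟩)
      calc k ≤ σ.cycleType.sum := Multiset.le_sum_of_mem hmem
        _ ≤ n := by
          rw [Equiv.Perm.sum_cycleType]
          simpa using Finset.card_le_univ σ.support
  · intro h m hm
    rw [Finset.mem_Icc] at hm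
    by_cases h1 : m = 1
    · rw [h1, count_one_partition_parts, h, sum_multisetOfCounts, hc]
    · rw [count_partition_parts_of_ne_one σ h1, h, count_multisetOfCounts,
        if_pos (Finset.mem_Icc.mpr (by omega))]

/-- For `c_1, …, c_n ∈ ℕ` with `∑ m·c_m = n`, the probability that a uniform permutation in
`S_n` has exactly `c_m` cycles of length `m` for every `m` is `∏_m (1/m)^{c_m}/c_m!`;
equivalently the count of such permutations times `∏_m m^{c_m} c_m!` equals `n!`. -/
theorem stmt14 (n : ℕ) (c : ℕ → ℕ) (hc : ∑ m ∈ Finset.Icc 1 n, m * c m = n) :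
    (Finset.univ.filter fun σ : Equiv.Perm (Fin n) =>
        ∀ m ∈ Finset.Icc 1 n, σ.partition.parts.count m = c m).card *
      ∏ m ∈ Finset.Icc 1 n, m ^ c m * (c m).factorial = Nat.factorial n := by
  rcases Nat.eq_zero_or_pos n with rfl | hn
  · simp
  have hIcc : Finset.Icc 1 n = insert 1 (Finset.Icc 2 n) := by
    ext k
    simp only [Finset.mem_Icc, Finset.mem_insert]
    omega
  have h1 : 1 ∉ Finset.Icc 2 n := by simp
  have hsum : c 1 + ∑ k ∈ Finset.Icc 2 n, k * c k = n := by
    rwa [hIcc, Finset.sum_insert h1, one_mul] at hc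
  have hsub : n - ∑ k ∈ Finset.Icc 2 n, k * c k = c 1 := by omega
  have key := Equiv.Perm.card_of_cycleType_mul_eq (Fin n) (multisetOfCounts (Finset.Icc 2 n) c)
  rw [if_pos ⟨by rw [sum_multisetOfCounts, Fintype.card_fin]; omega,
      fun a ha => (Finset.mem_Icc.mp (mem_of_mem_multisetOfCounts ha)).1⟩,
    prod_factorial_count_multisetOfCounts, prod_multisetOfCounts, sum_multisetOfCounts,
    Fintype.card_fin, hsub] at key
  rw [← key]
  simp only [count_partition_parts_eq_iff hsub]
  rw [hIcc, Finset.prod_insert h1, Finset.prod_mul_distrib, one_pow, one_mul,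
    mul_assoc (c 1).factorial]
end
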